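/- Let G be a digraph on n vertices with no self-loops that does NOT contain a reverse directed spanning tree (i.e., no vertex is reachable from every vertex by a directed path). Then for every choice of local distributed feedbacks — locally Lipschitz functions u_i, ω_i of the list of body-frame relative displacements (R(θ_i)⁻¹(x_j − x_i))_{j ∈ N_i} — the resulting closed-loop unicycle system does not achieve global rendezvous: it is not the case that every maximal solution is defined on all of [0,∞) and satisfies D(x(t)) → 0 as t → ∞. -/

import Mathlib

open Matrix
open scoped BigOperators ENNReal

/-- The rotation matrix `R(θ)`. -/
noncomputable def rotM (θ : ℝ) : Matrix (Fin 2) (Fin 2) ℝ :=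
  !![Real.cos θ, -Real.sin θ; Real.sin θ, Real.cos θ]

/-- Euclidean norm on ℝ². -/
noncomputable def enorm2 (v : Fin 2 → ℝ) : ℝ :=
  Real.sqrt (v 0 ^ 2 + v 1 ^ 2)

/-- The body-frame relative displacements available to robot `i`:
`j ↦ R(θᵢ)⁻¹ (x_j - x_i)`. -/
noncomputable def relDisp {n : ℕ} (x : Fin n → Fin 2 → ℝ) (θi : ℝ) (i : Fin n) :
    Fin n → Fin 2 → ℝ :=
  fun j => (rotM θi)⁻¹ *ᵥ (x j - x i)

/-- `(x, θ)` is a solution on `[0, T)` of the unicycle system closed with the local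
distributed feedback `(u, ω)` depending on body-frame relative displacements. -/
def IsSolOnFB {n : ℕ} (u ω : Fin n → (Fin n → Fin 2 → ℝ) → ℝ)
    (x : ℝ → Fin n → Fin 2 → ℝ) (θ : ℝ → Fin n → ℝ) (T : ℝ≥0∞) : Prop :=
  ∀ t : ℝ, 0 ≤ t → ENNReal.ofReal t < T → ∀ i : Fin n,
    HasDerivWithinAt (fun s => x s i)
      (u i (relDisp (x t) (θ t i) i) • (rotM (θ t i) *ᵥ ![1, 0])) (Set.Ici 0) t ∧
    HasDerivWithinAt (fun s => θ s i) (ω i (relDisp (x t) (θ t i) i)) (Set.Ici 0) t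

/-- A maximal solution: a solution on `[0, T)` admitting no proper extension. -/
def IsMaxSolFB {n : ℕ} (u ω : Fin n → (Fin n → Fin 2 → ℝ) → ℝ)
    (x : ℝ → Fin n → Fin 2 → ℝ) (θ : ℝ → Fin n → ℝ) (T : ℝ≥0∞) : Prop :=
  IsSolOnFB u ω x θ T ∧
    ∀ (x' : ℝ → Fin n → Fin 2 → ℝ) (θ' : ℝ → Fin n → ℝ) (T' : ℝ≥0∞),
      T < T' → IsSolOnFB u ω x' θ' T' →
        ¬(∀ t : ℝ, 0 ≤ t → ENNReal.ofReal t < T → x' t = x t ∧ θ' t = θ t)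

/-- `D(x) = max_{i,j} ‖x_i - x_j‖`. -/
noncomputable def Dmax {n : ℕ} (x : Fin n → Fin 2 → ℝ) : ℝ :=
  ⨆ i : Fin n, ⨆ j : Fin n, enorm2 (x i - x j)

section LocallyLipschitzODE

variable {E : Type*} [NormedAddCommGroup E] [NormedSpace ℝ E]

/-- `γ` is a solution on `[0, T)` of the autonomous equation `γ' = F γ`. -/
def SolvesOn (F : E → E) (γ : ℝ → E) (T : ℝ≥0∞) : Prop :=
  ∀ t : ℝ, 0 ≤ t → ENNReal.ofReal t < T → HasDerivWithinAt γ (F (γ t)) (Set.Ici 0) t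

theorem SolvesOn.mono {F : E → E} {γ : ℝ → E} {S T : ℝ≥0∞} (h : SolvesOn F γ T) (hST : S ≤ T) :
    SolvesOn F γ S :=
  fun t ht htS => h t ht (htS.trans_le hST)

/-- Solutions of a locally Lipschitz equation are determined by their initial value. -/
theorem SolvesOn.unique {F : E → E} (hF : LocallyLipschitz F) {γ₁ γ₂ : ℝ → E} {T : ℝ≥0∞}
    (h₁ : SolvesOn F γ₁ T) (h₂ : SolvesOn F γ₂ T) (h0 : γ₁ 0 = γ₂ 0)
    {t : ℝ} (ht : 0 ≤ t) (htT : ENNReal.ofReal t < T) : γ₁ t = γ₂ t := by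
  have before : ∀ s ∈ Set.Icc 0 t, ENNReal.ofReal s < T := fun s hs =>
    (ENNReal.ofReal_le_ofReal hs.2).trans_lt htT
  have cont : ∀ {γ : ℝ → E}, SolvesOn F γ T → ContinuousOn γ (Set.Icc 0 t) := fun h s hs =>
    (h s hs.1 (before s hs)).continuousWithinAt.mono Set.Icc_subset_Ici_self
  have deriv : ∀ {γ : ℝ → E}, SolvesOn F γ T →
      ∀ s ∈ Set.Ico 0 t, HasDerivWithinAt γ (F (γ s)) (Set.Ici s) s := fun h s hs =>
    (h s hs.1 (before s ⟨hs.1, hs.2.le⟩)).mono (Set.Ici_subset_Ici.2 hs.1)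
  obtain ⟨K, hK⟩ := LocallyLipschitzOn.exists_lipschitzOnWith_of_compact
    ((isCompact_Icc.image_of_continuousOn (cont h₁)).union
      (isCompact_Icc.image_of_continuousOn (cont h₂))) hF.locallyLipschitzOn
  exact ODE_solution_unique_of_mem_Icc_right (v := fun _ => F) (fun _ _ => hK)
    (cont h₁) (deriv h₁)
    (fun s hs => Or.inl (Set.mem_image_of_mem _ ⟨hs.1, hs.2.le⟩))
    (cont h₂) (deriv h₂)
    (fun s hs => Or.inr (Set.mem_image_of_mem _ ⟨hs.1, hs.2.le⟩)) h0 ⟨ht, le_rfl⟩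

/-- Local existence for locally Lipschitz equations. -/
theorem exists_solvesOn_of_locallyLipschitz [CompleteSpace E] {F : E → E}
    (hF : LocallyLipschitz F) (z : E) :
    ∃ (γ : ℝ → E) (T : ℝ≥0∞), γ 0 = z ∧ 0 < T ∧ SolvesOn F γ T := by
  obtain ⟨K, s, hs, hK⟩ := hF z
  obtain ⟨a, ha, has⟩ := Metric.nhds_basis_closedBall.mem_iff.1 hs
  lift a to NNReal using ha.le
  have hK' := hK.mono has
  set L : NNReal := ‖F z‖₊ + K * a with hL
  have hb : ∀ x ∈ Metric.closedBall z a, ‖F x‖ ≤ L := by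
    intro x hx
    have hdist := hK'.dist_le_mul x hx z (Metric.mem_closedBall_self ha.le)
    have hxz : (K : ℝ) * dist x z ≤ K * a := by gcongr; exact hx
    have htri : ‖F x‖ ≤ ‖F z‖ + dist (F x) (F z) := by
      rw [dist_eq_norm]; exact norm_le_norm_add_norm_sub' _ _
    simp only [hL, NNReal.coe_add, NNReal.coe_mul, coe_nnnorm]
    linarith
  have hε : (0 : ℝ) < a / (L + 1) := by positivity
  have hpl : IsPicardLindelof (fun _ => F) (⟨0, le_rfl, hε.le⟩ : Set.Icc (0 : ℝ) (a / (L + 1)))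
      z a 0 L K := by
    refine IsPicardLindelof.of_time_independent hb hK' ?_
    simp only [sub_zero, sub_self, NNReal.coe_zero, max_eq_left hε.le]
    rw [mul_div_assoc', div_le_iff₀ (by positivity)]
    nlinarith [L.coe_nonneg]
  obtain ⟨γ, h0, hγ⟩ := hpl.exists_eq_forall_mem_Icc_hasDerivWithinAt₀
  refine ⟨γ, ENNReal.ofReal (a / (L + 1)), h0, ENNReal.ofReal_pos.2 hε, fun t ht htT => ?_⟩
  have htε := (ENNReal.ofReal_lt_ofReal_iff hε).1 htT
  refine (hγ t ⟨ht, htε.le⟩).mono_of_mem_nhdsWithin ?_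
  rw [← Set.Ici_inter_Iic]
  exact Filter.inter_mem self_mem_nhdsWithin (mem_nhdsWithin_of_mem_nhds (Iic_mem_nhds htε))

/-- A locally Lipschitz equation has, for each initial value, a solution with the longest
possible interval of existence. -/
theorem exists_maximal_solvesOn_of_locallyLipschitz [CompleteSpace E] {F : E → E}
    (hF : LocallyLipschitz F) (z : E) :
    ∃ (γ : ℝ → E) (T : ℝ≥0∞), γ 0 = z ∧ 0 < T ∧ SolvesOn F γ T ∧
      ∀ (γ' : ℝ → E) (T' : ℝ≥0∞), γ' 0 = z → SolvesOn F γ' T' → T' ≤ T := by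
  classical
  set S : Set ℝ≥0∞ := {T | ∃ γ : ℝ → E, γ 0 = z ∧ SolvesOn F γ T}
  obtain ⟨γ₀, T₀, hγ₀, hT₀, hsol₀⟩ := exists_solvesOn_of_locallyLipschitz hF z
  have hpos : 0 < sSup S := hT₀.trans_le (le_sSup ⟨γ₀, hγ₀, hsol₀⟩)
  have hex : ∀ t : ℝ, ENNReal.ofReal t < sSup S →
      ∃ (γ : ℝ → E) (T : ℝ≥0∞), γ 0 = z ∧ ENNReal.ofReal t < T ∧ SolvesOn F γ T := by
    intro t ht
    obtain ⟨T, ⟨γ, h0, hγ⟩, htT⟩ := lt_sSup_iff.1 ht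
    exact ⟨γ, T, h0, htT, hγ⟩
  choose! φ τ hφ0 hτ hφ using hex
  have glue : ∀ {s t : ℝ}, 0 ≤ s → ENNReal.ofReal s < sSup S → ENNReal.ofReal t < sSup S →
      ENNReal.ofReal s < τ t → φ s s = φ t s := by
    intro s t hs hsS htS hst
    exact SolvesOn.unique hF ((hφ s hsS).mono (min_le_left _ _))
      ((hφ t htS).mono (min_le_right (τ s) _)) ((hφ0 s hsS).trans (hφ0 t htS).symm) hs
      (lt_min (hτ s hsS) hst)
  refine ⟨fun t => φ t t, sSup S, hφ0 0 (by simpa using hpos), hpos, fun t ht htS => ?_,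
    fun γ' T' h0 h' => le_sSup ⟨γ', h0, h'⟩⟩
  refine (hφ t htS t ht (hτ t htS)).congr_of_eventuallyEq ?_ rfl
  have hev : ∀ᶠ s in nhds t, ENNReal.ofReal s < min (sSup S) (τ t) :=
    ENNReal.continuous_ofReal.continuousAt.eventually_lt continuousAt_const
      (lt_min htS (hτ t htS))
  filter_upwards [mem_nhdsWithin_of_mem_nhds hev, self_mem_nhdsWithin] with s hs hs0
  exact glue hs0 (lt_of_lt_of_le hs (min_le_left _ _)) htS (lt_of_lt_of_le hs (min_le_right _ _))

end LocallyLipschitzODE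

section ClosedLoop

variable {n : ℕ}

theorem LocallyLipschitz.pi {α : Type*} [PseudoEMetricSpace α] {ι : Type*} [Fintype ι]
    {β : ι → Type*} [∀ i, PseudoEMetricSpace (β i)] {f : ∀ i, α → β i}
    (hf : ∀ i, LocallyLipschitz (f i)) : LocallyLipschitz (fun a i => f i a) := by
  intro a
  choose K s hs hK using fun i => hf i a
  refine ⟨∑ i, K i, ⋂ i, s i, Filter.iInter_mem.2 hs, fun x hx y hy => ?_⟩
  refine edist_pi_le_iff.2 fun i => ?_
  refine (hK i (Set.mem_iInter.1 hx i) (Set.mem_iInter.1 hy i)).trans ?_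
  gcongr
  exact Finset.single_le_sum (f := K) (fun _ _ => zero_le) (Finset.mem_univ i)

theorem rotM_inv (θ : ℝ) : (rotM θ)⁻¹ = !![Real.cos θ, Real.sin θ; -Real.sin θ, Real.cos θ] := by
  refine Matrix.inv_eq_right_inv ?_
  ext i j
  have := Real.sin_sq_add_cos_sq θ
  fin_cases i <;> fin_cases j <;> simp [rotM, Matrix.mul_apply, Fin.sum_univ_two] <;> nlinarith

/-- The closed-loop vector field on the space of positions and headings. -/
noncomputable def closedLoopField (u ω : Fin n → (Fin n → Fin 2 → ℝ) → ℝ)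
    (z : (Fin n → Fin 2 → ℝ) × (Fin n → ℝ)) : (Fin n → Fin 2 → ℝ) × (Fin n → ℝ) :=
  (fun i => u i (relDisp z.1 (z.2 i) i) • (rotM (z.2 i) *ᵥ ![1, 0]),
    fun i => ω i (relDisp z.1 (z.2 i) i))

theorem isSolOnFB_iff_solvesOn {u ω : Fin n → (Fin n → Fin 2 → ℝ) → ℝ}
    {x : ℝ → Fin n → Fin 2 → ℝ} {θ : ℝ → Fin n → ℝ} {T : ℝ≥0∞} :
    IsSolOnFB u ω x θ T ↔ SolvesOn (closedLoopField u ω) (fun t => (x t, θ t)) T := by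
  refine forall_congr' fun t => forall_congr' fun _ => forall_congr' fun _ => ?_
  rw [forall_and]
  constructor
  · rintro ⟨hx, hθ⟩
    exact (hasDerivWithinAt_pi.2 hx).prodMk (hasDerivWithinAt_pi.2 hθ)
  · intro h
    exact ⟨hasDerivWithinAt_pi.1 h.fst, hasDerivWithinAt_pi.1 h.snd⟩

theorem locallyLipschitz_relDisp (i : Fin n) :
    LocallyLipschitz fun z : (Fin n → Fin 2 → ℝ) × (Fin n → ℝ) => relDisp z.1 (z.2 i) i := by
  refine ContDiff.locallyLipschitz (𝕂 := ℝ) ?_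
  refine contDiff_pi.2 fun j => contDiff_pi.2 fun k => ?_
  fin_cases k <;>
  · simp only [relDisp, rotM_inv, Matrix.mulVec, dotProduct, Fin.sum_univ_two]
    simp
    fun_prop

theorem locallyLipschitz_closedLoopField {u ω : Fin n → (Fin n → Fin 2 → ℝ) → ℝ}
    (hu : ∀ i, LocallyLipschitz (u i)) (hω : ∀ i, LocallyLipschitz (ω i)) :
    LocallyLipschitz (closedLoopField u ω) := by
  have hvel : LocallyLipschitz fun p : ℝ × ℝ => p.1 • (rotM p.2 *ᵥ ![1, 0]) := by
    refine ContDiff.locallyLipschitz (𝕂 := ℝ) (contDiff_pi.2 fun k => ?_)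
    fin_cases k <;>
    · simp [rotM]
      fun_prop
  have hθ : ∀ i, LocallyLipschitz fun z : (Fin n → Fin 2 → ℝ) × (Fin n → ℝ) => z.2 i := fun i =>
    ContDiff.locallyLipschitz (𝕂 := ℝ) (by fun_prop)
  exact (LocallyLipschitz.pi fun i =>
      hvel.comp (((hu i).comp (locallyLipschitz_relDisp i)).prodMk (hθ i))).prodMk
    (LocallyLipschitz.pi fun i => (hω i).comp (locallyLipschitz_relDisp i))

theorem exists_isMaxSolFB {u ω : Fin n → (Fin n → Fin 2 → ℝ) → ℝ}
    (hu : ∀ i, LocallyLipschitz (u i)) (hω : ∀ i, LocallyLipschitz (ω i))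
    (x₀ : Fin n → Fin 2 → ℝ) (θ₀ : Fin n → ℝ) :
    ∃ (x : ℝ → Fin n → Fin 2 → ℝ) (θ : ℝ → Fin n → ℝ) (T : ℝ≥0∞),
      x 0 = x₀ ∧ θ 0 = θ₀ ∧ IsMaxSolFB u ω x θ T := by
  obtain ⟨γ, T, h0, hT, hγ, hmax⟩ := exists_maximal_solvesOn_of_locallyLipschitz
    (locallyLipschitz_closedLoopField hu hω) (x₀, θ₀)
  refine ⟨fun t => (γ t).1, fun t => (γ t).2, T, by simp [h0], by simp [h0],
    isSolOnFB_iff_solvesOn.2 hγ, fun x' θ' T' hTT' hsol hext => ?_⟩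
  refine hTT'.not_ge (hmax _ T' ?_ (isSolOnFB_iff_solvesOn.1 hsol))
  obtain ⟨hx, hθ⟩ := hext 0 le_rfl (by simpa using hT)
  simp [hx, hθ, h0]

/-- On a set of robots closed under taking neighbours the motion is autonomous and
translation equivariant. -/
theorem IsSolOnFB.eq_add_of_closed {Adj : Fin n → Fin n → Bool}
    {u ω : Fin n → (Fin n → Fin 2 → ℝ) → ℝ}
    (hu : ∀ i, LocallyLipschitz (u i)) (hω : ∀ i, LocallyLipschitz (ω i))
    (hloc : ∀ (i : Fin n) (y y' : Fin n → Fin 2 → ℝ),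
      (∀ j, Adj i j = true → y j = y' j) → u i y = u i y' ∧ ω i y = ω i y')
    {C : Set (Fin n)} (hC : ∀ i ∈ C, ∀ j, Adj i j = true → j ∈ C) (c : Fin 2 → ℝ)
    {x x' : ℝ → Fin n → Fin 2 → ℝ} {θ θ' : ℝ → Fin n → ℝ} {T : ℝ≥0∞}
    (h : IsSolOnFB u ω x θ T) (h' : IsSolOnFB u ω x' θ' T)
    (hx0 : ∀ i ∈ C, x' 0 i = x 0 i + c) (hθ0 : ∀ i ∈ C, θ' 0 i = θ 0 i)
    {t : ℝ} (ht : 0 ≤ t) (htT : ENNReal.ofReal t < T) {i : Fin n} (hi : i ∈ C) :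
    x' t i = x t i + c := by
  classical
  set uC : Fin n → (Fin n → Fin 2 → ℝ) → ℝ := fun i => if i ∈ C then u i else fun _ => 0 with huC
  set ωC : Fin n → (Fin n → Fin 2 → ℝ) → ℝ := fun i => if i ∈ C then ω i else fun _ => 0 with hωC
  have huC_lip : ∀ i, LocallyLipschitz (uC i) := fun i => by
    by_cases hi : i ∈ C
    · simpa [huC, hi] using hu i
    · simpa [huC, hi] using LocallyLipschitz.const (0 : ℝ)
  have hωC_lip : ∀ i, LocallyLipschitz (ωC i) := fun i => by
    by_cases hi : i ∈ C
    · simpa [hωC, hi] using hω i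
    · simpa [hωC, hi] using LocallyLipschitz.const (0 : ℝ)
  have masked : ∀ (d : Fin 2 → ℝ) {y : ℝ → Fin n → Fin 2 → ℝ} {η : ℝ → Fin n → ℝ},
      IsSolOnFB u ω y η T →
      IsSolOnFB uC ωC (fun t i => if i ∈ C then y t i + d else 0)
        (fun t i => if i ∈ C then η t i else 0) T := by
    intro d y η hy t ht htT i
    by_cases hi : i ∈ C
    · obtain ⟨hu_eq, hω_eq⟩ := hloc i
        (relDisp (fun i => if i ∈ C then y t i + d else 0) (η t i) i) (relDisp (y t) (η t i) i)
        (fun j hj => by simp [relDisp, hi, hC i hi j hj])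
      simp only [huC, hωC, hi, if_true, hu_eq, hω_eq]
      exact ⟨(hy t ht htT i).1.add_const d, (hy t ht htT i).2⟩
    · simp only [huC, hωC, hi, if_false, zero_smul]
      exact ⟨hasDerivWithinAt_const _ _ _, hasDerivWithinAt_const _ _ _⟩
  have heq := SolvesOn.unique (locallyLipschitz_closedLoopField huC_lip hωC_lip)
    (isSolOnFB_iff_solvesOn.1 (masked 0 h')) (isSolOnFB_iff_solvesOn.1 (masked c h))
    (by
      refine Prod.ext (funext fun i => ?_) (funext fun i => ?_)
      · by_cases hi : i ∈ C <;> simp [hi, hx0]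
      · by_cases hi : i ∈ C <;> simp [hi, hθ0]) ht htT
  simpa [hi] using congrFun (congrArg Prod.fst heq) i

theorem abs_apply_zero_sub_le_Dmax (x : Fin n → Fin 2 → ℝ) (i j : Fin n) :
    |x i 0 - x j 0| ≤ Dmax x := by
  have hnorm : |x i 0 - x j 0| ≤ enorm2 (x i - x j) :=
    Real.abs_le_sqrt (by simpa using sq_nonneg (x i 1 - x j 1))
  have hj : enorm2 (x i - x j) ≤ ⨆ k, enorm2 (x i - x k) :=
    le_ciSup (f := fun k => enorm2 (x i - x k)) (Set.finite_range _).bddAbove j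
  exact hnorm.trans (hj.trans
    (le_ciSup (f := fun l => ⨆ k, enorm2 (x l - x k)) (Set.finite_range _).bddAbove i))

end ClosedLoop

/-- If no vertex of a finite nonempty relation is reachable from all others, then two vertices
have disjoint sets of reachable vertices. -/
theorem exists_disjoint_reachable {V : Type*} [Finite V] [Nonempty V] {r : V → V → Prop}
    (h : ¬∃ b, ∀ a, Relation.ReflTransGen r a b) :
    ∃ a b, Disjoint {k | Relation.ReflTransGen r a k} {k | Relation.ReflTransGen r b k} := by
  obtain ⟨b, hb⟩ := Finite.exists_min fun b => {k | Relation.ReflTransGen r b k}.ncard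
  push Not at h
  obtain ⟨a, hab⟩ := h b
  refine ⟨a, b, Set.disjoint_left.2 fun k hak hbk => hab ?_⟩
  have hsub : {l | Relation.ReflTransGen r k l} ⊆ {l | Relation.ReflTransGen r b l} :=
    fun l hkl => Relation.ReflTransGen.trans hbk hkl
  have heq := Set.eq_of_subset_of_ncard_le hsub (hb k) (Set.toFinite _)
  have hkb : b ∈ {l | Relation.ReflTransGen r k l} := heq ▸ Relation.ReflTransGen.refl
  exact Relation.ReflTransGen.trans hak hkb

/-- if the digraph (no self-loops) does NOT contain a reverse directed
spanning tree, then no local distributed feedback — locally Lipschitz functions of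
the body-frame relative displacements to the neighbours — achieves global
rendezvous: it is not the case that every maximal solution is complete and
satisfies `D(x(t)) → 0`. -/
theorem no_rendezvous_without_spanning_tree {n : ℕ} (hn : 0 < n)
    (Adj : Fin n → Fin n → Bool) (hloop : ∀ i, Adj i i = false)
    (hnotree : ¬∃ r : Fin n, ∀ i, Relation.ReflTransGen (fun p q => Adj p q = true) i r) :
    ∀ u ω : Fin n → (Fin n → Fin 2 → ℝ) → ℝ,
      (∀ i, LocallyLipschitz (u i)) →
      (∀ i, LocallyLipschitz (ω i)) →
      (∀ (i : Fin n) (y y' : Fin n → Fin 2 → ℝ),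
          (∀ j, Adj i j = true → y j = y' j) → u i y = u i y' ∧ ω i y = ω i y') →
      ¬(∀ (x : ℝ → Fin n → Fin 2 → ℝ) (θ : ℝ → Fin n → ℝ) (T : ℝ≥0∞),
          IsMaxSolFB u ω x θ T →
            T = ⊤ ∧ Filter.Tendsto (fun t => Dmax (x t)) Filter.atTop (nhds 0)) := by
  intro u ω hu hω hloc hall
  classical
  have : Nonempty (Fin n) := ⟨⟨0, hn⟩⟩
  obtain ⟨a, b, hdisj⟩ := exists_disjoint_reachable hnotree
  have hclosed : ∀ v : Fin n, ∀ i ∈ {k | Relation.ReflTransGen (fun p q => Adj p q = true) v k},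
      ∀ j, Adj i j = true → j ∈ {k | Relation.ReflTransGen (fun p q => Adj p q = true) v k} :=
    fun v i hi j hij => Relation.ReflTransGen.tail hi hij
  set A := {k | Relation.ReflTransGen (fun p q => Adj p q = true) a k}
  set B := {k | Relation.ReflTransGen (fun p q => Adj p q = true) b k}
  obtain ⟨x, θ, T, hx0, hθ0, hmax⟩ := exists_isMaxSolFB hu hω 0 0
  obtain ⟨x', θ', T', hx0', hθ0', hmax'⟩ := exists_isMaxSolFB hu hω
    (fun i => if i ∈ A then ![1, 0] else 0) 0
  obtain ⟨rfl, hD⟩ := hall x θ T hmax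
  obtain ⟨rfl, hD'⟩ := hall x' θ' T' hmax'
  have hA : ∀ t : ℝ, 0 ≤ t → x' t a = x t a + ![1, 0] := fun t ht =>
    hmax.1.eq_add_of_closed hu hω hloc (hclosed a) ![1, 0] hmax'.1
      (fun i (hi : i ∈ A) => by simp [hx0, hx0', hi]) (fun i _ => by simp [hθ0, hθ0'])
      ht ENNReal.ofReal_lt_top Relation.ReflTransGen.refl
  have hB : ∀ t : ℝ, 0 ≤ t → x' t b = x t b + 0 := fun t ht =>
    hmax.1.eq_add_of_closed hu hω hloc (hclosed b) 0 hmax'.1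
      (fun i hi => by simp [hx0, hx0', Set.disjoint_right.1 hdisj hi])
      (fun i _ => by simp [hθ0, hθ0'])
      ht ENNReal.ofReal_lt_top Relation.ReflTransGen.refl
  obtain ⟨t, ht, ht0⟩ := (((hD.add hD').eventually_lt_const
    (show (0 : ℝ) + 0 < 1 by norm_num)).and (Filter.eventually_ge_atTop 0)).exists
  have h₁ := abs_le.1 (abs_apply_zero_sub_le_Dmax (x t) a b)
  have h₂ := abs_le.1 (abs_apply_zero_sub_le_Dmax (x' t) a b)
  rw [hA t ht0, hB t ht0] at h₂
  simp only [Pi.add_apply, Matrix.cons_val_zero, Pi.zero_apply] at h₂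
  linarith [h₁.1, h₂.2]
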